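/- arXiv:1902.09284 — 2 statements merged into one kernel-verified Lean document; each statement's English description precedes it below -/
import Mathlib

section
/- Let X be a Banach space with modulus of uniform convexity Φ, let T : C → C (C ⊆ X) satisfy B_r[p] ⊆ Fix(T) for some p ∈ X and r > 0 with r/K ≤ 2, let x ∈ C with ‖x − p‖ < K, and let Γ(K, r, ε, g, N) be a metastable rate of asymptotic decreasingness for (‖T^n x − q‖)_{n∈ℕ} uniform in q ∈ B_r[p]. Then for every ε > 0 with ε/(2K) ∈ (0,4] and every g : ℕ → ℕ there exists n ≤ Ω(Φ, Γ, K, r, ε, g) such that ‖T^i x − T^j x‖ ≤ ε for all i, j ∈ [n, n + g(n)], where Ω(Φ, Γ, K, r, ε, g) := Γ*(K, r, η, g, f^(⌈K/η⌉)(0)), f(j) := Γ*(K, r, η, g, j) + g*(Γ*(K, r, η, g, j)), η := (r/4)·min(1, Ψ(min(1/4, r/K), ε/(2K))), and Ψ(h, ε') := min(ε'/2, 2h·Φ(ε'/2)). -/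
/-- `fStar g n = max_{i ≤ n} max (n, g i)`. -/
def fStar (g : ℕ → ℕ) (n : ℕ) : ℕ := (Finset.range (n + 1)).sup fun i => max n (g i)

/-- `ΓStar Γ K r ε g N = max_{i ≤ N} max (N, Γ K r ε g i)`. -/
def ΓStar (Γ : ℝ → ℝ → ℝ → (ℕ → ℕ) → ℕ → ℕ) (K r ε : ℝ) (g : ℕ → ℕ) (N : ℕ) : ℕ :=
  (Finset.range (N + 1)).sup fun i => max N (Γ K r ε g i)

/-- `Ψ(h, ε') := min (ε'/2) (2h·Φ(ε'/2))`. -/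
noncomputable def Psi (Φ : ℝ → ℝ) (h ε' : ℝ) : ℝ := min (ε' / 2) (2 * h * Φ (ε' / 2))

/-- `η := (r/4)·min 1 (Ψ (min (1/4) (r/K)) (ε/(2K)))`. -/
noncomputable def eta (Φ : ℝ → ℝ) (K r ε : ℝ) : ℝ :=
  r / 4 * min 1 (Psi Φ (min (1 / 4) (r / K)) (ε / (2 * K)))

/-- `f j := Γ*(K, r, η, g, j) + g*(Γ*(K, r, η, g, j))`. -/
def fIter (Γ : ℝ → ℝ → ℝ → (ℕ → ℕ) → ℕ → ℕ) (K r η : ℝ) (g : ℕ → ℕ) (j : ℕ) : ℕ :=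
  ΓStar Γ K r η g j + fStar g (ΓStar Γ K r η g j)

/-- `Ω(Φ, Γ, K, r, ε, g) := Γ*(K, r, η, g, f^(⌈K/η⌉)(0))`. -/
noncomputable def Omega (Φ : ℝ → ℝ) (Γ : ℝ → ℝ → ℝ → (ℕ → ℕ) → ℕ → ℕ) (K r ε : ℝ) (g : ℕ → ℕ) : ℕ :=
  ΓStar Γ K r (eta Φ K r ε) g ((fIter Γ K r (eta Φ K r ε) g)^[⌈K / eta Φ K r ε⌉₊] 0)

theorem fStar_mono (g : ℕ → ℕ) : Monotone (fStar g) := by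
  intro a b hab
  refine Finset.sup_le fun i hi => ?_
  rw [Finset.mem_range] at hi
  exact (max_le_max_right (g i) hab).trans
    (Finset.le_sup (f := fun i => max b (g i)) (Finset.mem_range.2 (by omega)))

theorem le_fStar (g : ℕ → ℕ) (n : ℕ) : g n ≤ fStar g n :=
  (le_max_right n (g n)).trans
    (Finset.le_sup (f := fun i => max n (g i)) (Finset.self_mem_range_succ n))

theorem id_le_fStar (g : ℕ → ℕ) (n : ℕ) : n ≤ fStar g n :=
  (le_max_left n (g n)).trans
    (Finset.le_sup (f := fun i => max n (g i)) (Finset.self_mem_range_succ n))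

theorem ΓStar_mono (Γ : ℝ → ℝ → ℝ → (ℕ → ℕ) → ℕ → ℕ) (K r ε : ℝ) (g : ℕ → ℕ) :
    Monotone (ΓStar Γ K r ε g) :=
  fStar_mono _

theorem le_ΓStar (Γ : ℝ → ℝ → ℝ → (ℕ → ℕ) → ℕ → ℕ) (K r ε : ℝ) (g : ℕ → ℕ) (n : ℕ) :
    Γ K r ε g n ≤ ΓStar Γ K r ε g n :=
  le_fStar _ n

theorem fIter_mono (Γ : ℝ → ℝ → ℝ → (ℕ → ℕ) → ℕ → ℕ) (K r η : ℝ) (g : ℕ → ℕ) :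
    Monotone (fIter Γ K r η g) := fun _ _ hab =>
  add_le_add (ΓStar_mono Γ K r η g hab) (fStar_mono g (ΓStar_mono Γ K r η g hab))

theorem id_le_fIter (Γ : ℝ → ℝ → ℝ → (ℕ → ℕ) → ℕ → ℕ) (K r η : ℝ) (g : ℕ → ℕ) (n : ℕ) :
    n ≤ fIter Γ K r η g n :=
  (id_le_fStar (Γ K r η g) n).trans (Nat.le_add_right _ _)

/-- A nonnegative sequence starting below `K` has an index `j ≤ F^(⌈K/η⌉)(0)` at which it is
minimal up to `η` among all indices `≤ F j`. -/
theorem exists_almost_min (a : ℕ → ℝ) (ha : ∀ n, 0 ≤ a n) {K η : ℝ} (hη : 0 < η) (h0 : a 0 < K)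
    {F : ℕ → ℕ} (hF : Monotone F) (hid : ∀ n, n ≤ F n) :
    ∃ j ≤ F^[⌈K / η⌉₊] 0, a j < K ∧ ∀ i ≤ F j, a j ≤ a i + η := by
  have key : ∀ k : ℕ, (∃ j ≤ F^[k] 0, a j < K ∧ ∀ i ≤ F j, a j ≤ a i + η) ∨
      ∃ j ≤ F^[k] 0, a j < K - k * η := by
    intro k
    induction k with
    | zero => exact Or.inr ⟨0, le_rfl, by simpa using h0⟩
    | succ k ih =>
      rw [Function.iterate_succ_apply']
      rcases ih with ⟨j, hj, h⟩ | ⟨j, hj, h⟩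
      · exact Or.inl ⟨j, hj.trans (hid _), h⟩
      · by_cases hgood : ∀ i ≤ F j, a j ≤ a i + η
        · have : 0 ≤ (k : ℝ) * η := by positivity
          exact Or.inl ⟨j, hj.trans (hid _), by linarith, hgood⟩
        · push Not at hgood
          obtain ⟨i, hi, hlt⟩ := hgood
          refine Or.inr ⟨i, hi.trans (hF hj), ?_⟩
          push_cast
          linarith
  rcases key ⌈K / η⌉₊ with h | ⟨j, -, hj⟩
  · exact h
  · have h1 : K ≤ ⌈K / η⌉₊ * η := (div_le_iff₀ hη).1 (Nat.le_ceil _)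
    linarith [ha j]

/-- If `b` is almost as long as `a` and almost as close to `h • a` as `a` is, then uniform
convexity (at a single scale `δ` with modulus `φ`) forces `b` to be close to `a`. -/
theorem norm_sub_le_of_almost_min {X : Type*} [NormedAddCommGroup X] [NormedSpace ℝ X]
    {δ φ : ℝ} (huc : ∀ x₁ x₂ : X, ‖x₁‖ ≤ 1 → ‖x₂‖ ≤ 1 →
      (1 : ℝ) / 2 * ‖x₁ + x₂‖ ≥ 1 - φ → ‖x₁ - x₂‖ ≤ δ)
    {a b : X} {h η : ℝ} (ha : 0 < ‖a‖) (hh : 0 < h) (hh2 : h ≤ 1 / 2) (hη : 0 < η)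
    (hηφ : η ≤ h * ‖a‖ * φ) (hb : ‖a‖ ≤ ‖b‖ + η) (hbq : ‖b - h • a‖ ≤ (1 - h) * ‖a‖ + η) :
    ‖b - a‖ ≤ (1 - h) * ‖a‖ * δ + η := by
  set R := ‖a‖ with hR
  set s := (1 - h) * R + η with hs
  have hRh : 0 ≤ (1 - h) * R := mul_nonneg (by linarith) ha.le
  have hs0 : 0 < s := by linarith
  have hhR : 0 < h * R := mul_pos hh ha
  set u : X := s⁻¹ • (b - h • a) with hu
  set v : X := R⁻¹ • a with hv
  have hu1 : ‖u‖ ≤ 1 := by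
    rw [hu, norm_smul, Real.norm_of_nonneg (by positivity), inv_mul_le_iff₀ hs0]
    linarith
  have hv1 : ‖v‖ ≤ 1 := by
    rw [hv, norm_smul, Real.norm_of_nonneg (by positivity), ← hR, inv_mul_cancel₀ ha.ne']
  have hsu : s • u = b - h • a := smul_inv_smul₀ hs0.ne' _
  have hRv : R • v = a := smul_inv_smul₀ ha.ne' _
  have hsh : 0 ≤ s - h * R := by nlinarith
  have hbe : b = (s - h * R) • u + (h * R) • (u + v) := by
    have : b = s • u + h • (R • v) := by rw [hsu, hRv]; abel
    rw [this]; module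
  have hnb : ‖b‖ ≤ (s - h * R) + h * R * ‖u + v‖ := by
    calc ‖b‖ ≤ ‖(s - h * R) • u‖ + ‖(h * R) • (u + v)‖ := by
          conv_lhs => rw [hbe]
          exact norm_add_le _ _
      _ = (s - h * R) * ‖u‖ + h * R * ‖u + v‖ := by
          rw [norm_smul_of_nonneg hsh, norm_smul_of_nonneg hhR.le]
      _ ≤ _ := by gcongr; exact mul_le_of_le_one_right hsh hu1
  have huv : ‖u - v‖ ≤ δ := by
    refine huc u v hu1 hv1 ?_
    by_contra! hlt
    have h3 : h * R * ‖u + v‖ < h * R * (2 * (1 - φ)) :=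
      mul_lt_mul_of_pos_left (by linarith) hhR
    linarith
  have hba : b - a = ((1 - h) * R) • (u - v) + η • u := by
    have h1 : b = s • u + h • (R • v) := by rw [hsu, hRv]; abel
    have h2 : b - a = s • u + h • (R • v) - R • v := by rw [← h1, hRv]
    rw [h2, hs]; module
  calc ‖b - a‖ ≤ ‖((1 - h) * R) • (u - v)‖ + ‖η • u‖ := by rw [hba]; exact norm_add_le _ _
    _ = (1 - h) * R * ‖u - v‖ + η * ‖u‖ := by
        rw [norm_smul_of_nonneg hRh, norm_smul_of_nonneg hη.le]
    _ ≤ _ := by gcongr; exact mul_le_of_le_one_right hη.le hu1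

/-- Quantitative main theorem: rate of metastability for the Picard iterates. -/
theorem stmt14 {X : Type*} [NormedAddCommGroup X] [NormedSpace ℝ X] [CompleteSpace X]
    (Φ : ℝ → ℝ) (hΦrange : ∀ ε ∈ Set.Ioc (0 : ℝ) 2, Φ ε ∈ Set.Ioc (0 : ℝ) 1)
    (hΦ : ∀ x₁ x₂ : X, ‖x₁‖ ≤ 1 → ‖x₂‖ ≤ 1 → ∀ ε ∈ Set.Ioc (0 : ℝ) 2,
      (1 : ℝ) / 2 * ‖x₁ + x₂‖ ≥ 1 - Φ ε → ‖x₁ - x₂‖ ≤ ε)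
    (C : Set X) (T : X → X) (hT : Set.MapsTo T C C)
    (p : X) (r : ℝ) (hr : 0 < r)
    (hball : Metric.closedBall p r ⊆ {y | y ∈ C ∧ T y = y})
    (x : X) (hx : x ∈ C) (K : ℝ) (hK : 0 < K) (hxp : ‖x - p‖ < K) (hrK : r / K ≤ 2)
    (Γ : ℝ → ℝ → ℝ → (ℕ → ℕ) → ℕ → ℕ)
    (hΓ : ∀ ε > (0 : ℝ), ∀ g : ℕ → ℕ, ∀ N : ℕ, ∀ q ∈ Metric.closedBall p r,
      ∃ n ≤ Γ K r ε g N, ∀ i ∈ Set.Icc n (n + g n), ‖T^[i] x - q‖ ≤ ‖T^[N] x - q‖ + ε) :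
    ∀ ε > (0 : ℝ), ε / (2 * K) ∈ Set.Ioc (0 : ℝ) 4 → ∀ g : ℕ → ℕ,
      ∃ n ≤ Omega Φ Γ K r ε g, ∀ i ∈ Set.Icc n (n + g n), ∀ j ∈ Set.Icc n (n + g n),
        ‖T^[i] x - T^[j] x‖ ≤ ε := by
  intro ε hε he g
  set e := ε / (2 * K) with he_def
  have hεe : ε = 2 * (K * e) := by rw [he_def]; field_simp
  set h := min (1 / 4) (r / K) with hh_def
  have hh : 0 < h := by positivity
  have hh4 : h ≤ 1 / 4 := min_le_left _ _
  have hhK : h * K ≤ r := (le_div_iff₀ hK).1 (min_le_right _ _)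
  have he0 : 0 < e := he.1
  have he2 : e / 2 ∈ Set.Ioc (0 : ℝ) 2 := ⟨by linarith, by linarith [he.2]⟩
  have hΦ0 : 0 < Φ (e / 2) := (hΦrange _ he2).1
  have hη_def : eta Φ K r ε = r / 4 * min 1 (min (e / 2) (2 * h * Φ (e / 2))) := rfl
  unfold Omega
  set η := eta Φ K r ε
  have hη : 0 < η := by rw [hη_def]; positivity
  have hη1 : η ≤ r / 4 * (e / 2) := by
    rw [hη_def]; gcongr; exact (min_le_right _ _).trans (min_le_left _ _)
  have hη2 : η ≤ r / 4 * (2 * h * Φ (e / 2)) := by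
    rw [hη_def]; gcongr; exact (min_le_right _ _).trans (min_le_right _ _)
  have hrK' : r ≤ 2 * K := (div_le_iff₀ hK).1 hrK
  have hη3 : η ≤ K * e / 4 := by nlinarith
  have hKe : 0 < K * e := mul_pos hK he0
  obtain ⟨j, hj, hjK, hjmin⟩ := exists_almost_min (fun n => ‖T^[n] x - p‖)
    (fun _ => norm_nonneg _) hη hxp (fIter_mono Γ K r η g) (id_le_fIter Γ K r η g)
  suffices H : ∃ n ≤ Γ K r η g j, ∀ i ∈ Set.Icc n (n + g n), ‖T^[i] x - T^[j] x‖ ≤ K * e by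
    obtain ⟨n, hn, hclose⟩ := H
    refine ⟨n, hn.trans ((le_ΓStar Γ K r η g j).trans (ΓStar_mono Γ K r η g hj)), ?_⟩
    intro i hi k hk
    linarith [norm_sub_le_norm_sub_add_norm_sub (T^[i] x) (T^[j] x) (T^[k] x), hclose i hi,
      hclose k hk, norm_sub_rev (T^[j] x) (T^[k] x)]
  set a := T^[j] x - p with ha_def
  rcases le_or_gt ‖a‖ r with har | har
  · obtain ⟨n, hn, hdec⟩ := hΓ η hη g j (T^[j] x) (mem_closedBall_iff_norm.2 har)
    refine ⟨n, hn, fun i hi => ?_⟩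
    have := hdec i hi
    rw [sub_self, norm_zero] at this
    linarith
  · have hq : p + h • a ∈ Metric.closedBall p r := by
      rw [mem_closedBall_iff_norm, add_sub_cancel_left, norm_smul, Real.norm_of_nonneg hh.le]
      exact (mul_le_mul_of_nonneg_left hjK.le hh.le).trans hhK
    obtain ⟨n, hn, hdec⟩ := hΓ η hη g j _ hq
    refine ⟨n, hn, fun i hi => ?_⟩
    have hiF : i ≤ fIter Γ K r η g j := by
      have hnΓ := hn.trans (le_ΓStar Γ K r η g j)
      exact hi.2.trans (add_le_add hnΓ ((le_fStar g n).trans (fStar_mono g hnΓ)))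
    have hja : T^[j] x - (p + h • a) = (1 - h) • a := by
      rw [← sub_sub, ← ha_def]; module
    have hbq : ‖(T^[i] x - p) - h • a‖ ≤ (1 - h) * ‖a‖ + η := by
      have := hdec i hi
      rwa [hja, norm_smul, Real.norm_of_nonneg (by linarith), ← sub_sub] at this
    have hηφ : η ≤ h * ‖a‖ * Φ (e / 2) := by
      have : 0 < h * Φ (e / 2) := mul_pos hh hΦ0
      nlinarith
    have hmain := norm_sub_le_of_almost_min
      (fun x₁ x₂ h₁ h₂ => hΦ x₁ x₂ h₁ h₂ (e / 2) he2) (hr.trans har) hh (by linarith) hη hηφ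
      (hjmin i hiF) hbq
    rw [ha_def, sub_sub_sub_cancel_right, ← ha_def] at hmain
    have h1 : (1 - h) * ‖a‖ * (e / 2) ≤ K * (e / 2) := by
      have : (1 - h) * ‖a‖ ≤ K := by nlinarith [norm_nonneg a]
      gcongr
    linarith
end

section
/- Let T : C → C be a nonexpansive mapping on a subset C of a Banach space X with modulus of uniform convexity Φ, suppose B_r[p] ⊆ Fix(T) with r/K ≤ 2, and let x ∈ C with ‖x − p‖ < K. Then for every ε > 0 with ε/(2K) ∈ (0,4] and every g : ℕ → ℕ there exists n ≤ g̃^(⌈K/η⌉)(0) such that ‖T^i x − T^j x‖ ≤ ε for all i, j ∈ [n, n + g(n)], where g̃(j) := j + g*(j) and η := (r/4)·min(1, Ψ(min(1/4, r/K), ε/(2K))) with Ψ(h, ε') := min(ε'/2, 2h·Φ(ε'/2)). -/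
theorem eta_pos {Φ : ℝ → ℝ} {K r ε : ℝ} (hK : 0 < K) (hr : 0 < r) (hε : 0 < ε)
    (hΦ : 0 < Φ (ε / (2 * K) / 2)) : 0 < eta Φ K r ε := by
  unfold eta Psi
  positivity

theorem eta_le {Φ : ℝ → ℝ} {K r ε : ℝ} (hr : 0 < r) (hΦ : 0 < Φ (ε / (2 * K) / 2)) :
    eta Φ K r ε ≤ r * Φ (ε / (2 * K) / 2) := by
  set φ := Φ (ε / (2 * K) / 2)
  have hΨ : min 1 (Psi Φ (min (1 / 4) (r / K)) (ε / (2 * K))) ≤ 2 * min (1 / 4) (r / K) * φ :=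
    (min_le_right _ _).trans (min_le_right _ _)
  have hh : 2 * min (1 / 4) (r / K) * φ ≤ 2 * (1 / 4) * φ := by
    gcongr
    exact min_le_left _ _
  calc eta Φ K r ε ≤ r / 4 * (2 * (1 / 4) * φ) :=
        mul_le_mul_of_nonneg_left (hΨ.trans hh) (by positivity)
    _ ≤ r * φ := by nlinarith [mul_pos hr hΦ]

/-- A sequence of nonnegative reals starting below `m * η` decreases by less than `η` at one of
its first `m` steps. -/
theorem exists_lt_sub_succ_lt {b : ℕ → ℝ} {η : ℝ} {m : ℕ} (hb : ∀ k, 0 ≤ b k)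
    (hm : b 0 < m * η) : ∃ k < m, b k - b (k + 1) < η := by
  by_contra! h
  have hsum : ∑ _k ∈ Finset.range m, η ≤ ∑ k ∈ Finset.range m, (b k - b (k + 1)) :=
    Finset.sum_le_sum fun k hk => h k (Finset.mem_range.mp hk)
  rw [Finset.sum_range_sub', Finset.sum_const, Finset.card_range, nsmul_eq_mul] at hsum
  linarith [hb m]

/-- Metastability of antitone sequences of nonnegative reals. -/
theorem Antitone.exists_sub_lt_of_iterate {a : ℕ → ℝ} (ha : Antitone a) (ha₀ : ∀ n, 0 ≤ a n)
    {K η : ℝ} (hη : 0 < η) (hK : a 0 < K) (g : ℕ → ℕ) :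
    ∃ n ≤ (fun j => j + fStar g j)^[⌈K / η⌉₊] 0, a n - a (n + g n) < η := by
  set G : ℕ → ℕ := fun j => j + fStar g j with hG
  have hGid : id ≤ G := fun j => Nat.le_add_right j _
  obtain ⟨k, hk, hlt⟩ := exists_lt_sub_succ_lt (b := fun k => a (G^[k] 0)) (η := η)
    (m := ⌈K / η⌉₊) (fun k => ha₀ _) (hK.trans_le ((div_le_iff₀ hη).mp (Nat.le_ceil _)))
  refine ⟨G^[k] 0, Function.monotone_iterate_of_id_le hGid hk.le 0, ?_⟩
  have hstep : G^[k] 0 + g (G^[k] 0) ≤ G^[k + 1] 0 := by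
    rw [Function.iterate_succ_apply']
    exact Nat.add_le_add_left (le_fStar g _) _
  linarith [ha hstep]

section

variable {X : Type*} [NormedAddCommGroup X] [NormedSpace ℝ X]

/-- If `z` is at most as far as `w` from every point of the ball of radius `r` about `0`, and the
norm of `z` is close to that of `w`, then uniform convexity at `δ` forces `z` to be close
to `w`. -/
theorem norm_sub_le_of_forall_norm_sub_le {δ φ r : ℝ} (hδ : 0 ≤ δ) (hr : 0 < r)
    (hconv : ∀ x₁ x₂ : X, ‖x₁‖ ≤ 1 → ‖x₂‖ ≤ 1 → (1 : ℝ) / 2 * ‖x₁ + x₂‖ ≥ 1 - φ → ‖x₁ - x₂‖ ≤ δ)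
    {w z : X} (hwz : ∀ q : X, ‖q‖ ≤ r → ‖z - q‖ ≤ ‖w - q‖) (hnorm : ‖w‖ - ‖z‖ ≤ r * φ) :
    ‖w - z‖ ≤ ‖w‖ * δ := by
  rcases le_or_gt ‖w‖ r with hwr | hwr
  · have h := hwz w hwr
    rw [sub_self, norm_zero] at h
    rw [norm_sub_rev]
    exact h.trans (by positivity)
  set R := ‖w‖ with hR
  have hRpos : 0 < R := hr.trans hwr
  obtain ⟨t, ht⟩ : ∃ t, t = r / (2 * R) := ⟨_, rfl⟩
  have htR : 2 * t * R = r := by rw [ht]; field_simp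
  have ht0 : 0 < t := by rw [ht]; positivity
  have ht2 : 2 * t < 1 := by nlinarith
  have hs : 0 < (1 - t) * R := mul_pos (by linarith) hRpos
  set x₁ : X := ((1 - t) * R)⁻¹ • (z - t • w) with hx₁
  set x₂ : X := R⁻¹ • w with hx₂
  have hw : w = R • x₂ := by rw [hx₂, smul_inv_smul₀ hRpos.ne']
  have hz : z = R • ((1 - t) • x₁ + t • x₂) := by
    have h : z - t • w = ((1 - t) * R) • x₁ := by rw [hx₁, smul_inv_smul₀ hs.ne']
    rw [← sub_add_cancel z (t • w), h, hw]
    module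
  have h₁ : ‖x₁‖ ≤ 1 := by
    have htw : ‖t • w‖ ≤ r := by
      rw [norm_smul, Real.norm_of_nonneg ht0.le, ← hR]
      nlinarith
    have h := hwz (t • w) htw
    rw [show w - t • w = (1 - t) • w by module, norm_smul,
      Real.norm_of_nonneg (by linarith : 0 ≤ 1 - t), ← hR] at h
    rw [hx₁, norm_smul, norm_inv, Real.norm_of_nonneg hs.le]
    exact (inv_mul_le_one₀ hs).mpr h
  have h₂ : ‖x₂‖ ≤ 1 := by
    rw [hx₂, norm_smul, norm_inv, Real.norm_of_nonneg hRpos.le, ← hR,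
      inv_mul_cancel₀ hRpos.ne']
  have hmid : ‖z‖ ≤ R * ((1 - 2 * t) + t * ‖x₁ + x₂‖) := by
    have h : (1 - t) • x₁ + t • x₂ = (1 - 2 * t) • x₁ + t • (x₁ + x₂) := by module
    rw [hz, h, norm_smul, Real.norm_of_nonneg hRpos.le]
    gcongr
    refine (norm_add_le _ _).trans ?_
    rw [norm_smul (1 - 2 * t) x₁, norm_smul t (x₁ + x₂), Real.norm_of_nonneg ht0.le,
      Real.norm_of_nonneg (by linarith : 0 ≤ 1 - 2 * t)]
    gcongr
    exact mul_le_of_le_one_right (by linarith) h₁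
  have hx : (1 : ℝ) / 2 * ‖x₁ + x₂‖ ≥ 1 - φ := by
    have h : r * (1 - 1 / 2 * ‖x₁ + x₂‖) ≤ r * φ := by
      refine le_trans ?_ hnorm
      rw [← htR]
      linarith
    linarith [le_of_mul_le_mul_left h hr]
  have hsub : w - z = ((1 - t) * R) • (x₂ - x₁) := by
    rw [hz]
    nth_rewrite 1 [hw]
    module
  rw [hsub, norm_smul, Real.norm_of_nonneg hs.le, norm_sub_rev]
  gcongr
  · nlinarith
  · exact hconv x₁ x₂ h₁ h₂ hx

end

/-- The distance from the orbit of a nonexpansive map to a fixed point is antitone. -/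
theorem antitone_norm_iterate_sub {X : Type*} [NormedAddCommGroup X] {C : Set X} {T : X → X}
    (hT : Set.MapsTo T C C) (hnonexp : ∀ x ∈ C, ∀ y ∈ C, ‖T x - T y‖ ≤ ‖x - y‖)
    {x q : X} (hx : x ∈ C) (hq : q ∈ C) (hfix : T q = q) :
    Antitone fun n => ‖T^[n] x - q‖ := by
  refine antitone_nat_of_succ_le fun n => ?_
  have h := hnonexp _ (hT.iterate n hx) q hq
  rwa [hfix, ← Function.iterate_succ_apply' T n x] at h

/-- Rate of metastability for the Picard iterates of a nonexpansive map `T` with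
`B_r[p] ⊆ Fix T`: for every `ε > 0` with `ε/(2K) ∈ (0,4]` and every `g` there exists
`n ≤ g̃^(⌈K/η⌉)(0)`, where `g̃ j := j + g* j`, such that `‖T^i x - T^j x‖ ≤ ε` for all
`i, j ∈ [n, n + g n]`. -/
theorem stmt16 {X : Type*} [NormedAddCommGroup X] [NormedSpace ℝ X] [CompleteSpace X]
    (Φ : ℝ → ℝ) (hΦrange : ∀ ε ∈ Set.Ioc (0 : ℝ) 2, Φ ε ∈ Set.Ioc (0 : ℝ) 1)
    (hΦ : ∀ x₁ x₂ : X, ‖x₁‖ ≤ 1 → ‖x₂‖ ≤ 1 → ∀ ε ∈ Set.Ioc (0 : ℝ) 2,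
      (1 : ℝ) / 2 * ‖x₁ + x₂‖ ≥ 1 - Φ ε → ‖x₁ - x₂‖ ≤ ε)
    (C : Set X) (T : X → X) (hT : Set.MapsTo T C C)
    (hnonexp : ∀ x ∈ C, ∀ y ∈ C, ‖T x - T y‖ ≤ ‖x - y‖)
    (p : X) (r : ℝ) (hr : 0 < r)
    (hball : Metric.closedBall p r ⊆ {y | y ∈ C ∧ T y = y})
    (x : X) (hx : x ∈ C) (K : ℝ) (hK : 0 < K) (hxp : ‖x - p‖ < K) (hrK : r / K ≤ 2) :
    ∀ ε > (0 : ℝ), ε / (2 * K) ∈ Set.Ioc (0 : ℝ) 4 → ∀ g : ℕ → ℕ,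
      ∃ n ≤ (fun j => j + fStar g j)^[⌈K / eta Φ K r ε⌉₊] 0,
        ∀ i ∈ Set.Icc n (n + g n), ∀ j ∈ Set.Icc n (n + g n),
          ‖T^[i] x - T^[j] x‖ ≤ ε := by
  intro ε hε hεK g
  have hδ : ε / (2 * K) / 2 ∈ Set.Ioc (0 : ℝ) 2 := ⟨by positivity, by linarith [hεK.2]⟩
  have hΦpos := (hΦrange _ hδ).1
  have hanti : ∀ q ∈ Metric.closedBall p r, Antitone fun n => ‖T^[n] x - q‖ := fun q hq =>
    antitone_norm_iterate_sub hT hnonexp hx (hball hq).1 (hball hq).2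
  have hp := hanti p (Metric.mem_closedBall_self hr.le)
  obtain ⟨n, hn, hlt⟩ := hp.exists_sub_lt_of_iterate (fun _ => norm_nonneg _)
    (eta_pos hK hr hε hΦpos) hxp g
  refine ⟨n, hn, ?_⟩
  have key : ∀ i j, n ≤ i → i ≤ j → j ≤ n + g n → ‖T^[i] x - T^[j] x‖ ≤ ε := by
    intro i j hni hij hjn
    have hnorm : ‖T^[i] x - p‖ - ‖T^[j] x - p‖ ≤ r * Φ (ε / (2 * K) / 2) :=
      (sub_le_sub (hp hni) (hp hjn)).trans (hlt.le.trans (eta_le hr hΦpos))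
    have h := norm_sub_le_of_forall_norm_sub_le hδ.1.le hr
      (fun x₁ x₂ h₁ h₂ => hΦ x₁ x₂ h₁ h₂ _ hδ) (w := T^[i] x - p) (z := T^[j] x - p)
      (fun q hq => by
        have := hanti (p + q) (by simpa using hq) hij
        simpa only [sub_sub] using this) hnorm
    rw [sub_sub_sub_cancel_right] at h
    have hK' : ‖T^[i] x - p‖ ≤ K := (hp (Nat.zero_le i)).trans hxp.le
    calc ‖T^[i] x - T^[j] x‖ ≤ K * (ε / (2 * K) / 2) :=
          h.trans (mul_le_mul_of_nonneg_right hK' hδ.1.le)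
      _ = ε / 4 := by field_simp; norm_num
      _ ≤ ε := by linarith
  intro i hi j hj
  rcases le_total i j with hij | hij
  · exact key i j hi.1 hij hj.2
  · rw [norm_sub_rev]
    exact key j i hj.1 hij hi.2
end
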